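/- arXiv:1706.06086 — 2 statements merged into one kernel-verified Lean document; each statement's English description precedes it below -/
import Mathlib

section
/- Let (G,c) be a k-terminal network with terminal set Q, and assume that for every nontrivial partition Q = S ⊎ S̄ the minimum S-separating cut of (G,c) is unique as an edge set. Let A_{G,c} be the cutset-edge incidence matrix of (G,c). Then there exists an edge cost function c̃ : E(G) → ℝ_{>0} such that every mimicking network (G',c') for (G,c̃) satisfies |E(G')| ≥ rank(A_{G,c}), where the rank is taken over ℝ. -/
open scoped Classical

/-- A `k`-terminal network: a finite graph with real edge costs and an injective
labelling of `k` terminal vertices. -/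
structure Network (k : ℕ) : Type 1 where
  V : Type
  [fintypeV : Fintype V]
  [decEqV : DecidableEq V]
  edges : Finset (Sym2 V)
  cost : Sym2 V → ℝ
  term : Fin k → V
  term_inj : Function.Injective term

attribute [instance] Network.fintypeV Network.decEqV

namespace Network

variable {k : ℕ}

/-- All edge costs are positive reals. -/
def PosCosts (N : Network k) : Prop := ∀ e ∈ N.edges, 0 < N.cost e

/-- The vertex set `A` realizes the terminal partition `S ⊎ Sᶜ`:
terminals indexed by `S` are in `A` and the other terminals are outside `A`. -/
def Separates (N : Network k) (S : Finset (Fin k)) (A : Finset N.V) : Prop :=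
  ∀ i : Fin k, N.term i ∈ A ↔ i ∈ S

/-- The set of edges crossing the vertex bipartition `(A, V ∖ A)`. -/
noncomputable def cutset (N : Network k) (A : Finset N.V) : Finset (Sym2 N.V) :=
  N.edges.filter (fun e => (∃ u ∈ e, u ∈ A) ∧ (∃ v ∈ e, v ∉ A))

/-- The total cost of the edges crossing the bipartition `(A, V ∖ A)`. -/
noncomputable def cutWeight (N : Network k) (A : Finset N.V) : ℝ :=
  ∑ e ∈ N.cutset A, N.cost e

/-- The minimum weight of an `S`-separating cut. -/
noncomputable def mincut (N : Network k) (S : Finset (Fin k)) : ℝ :=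
  sInf {w : ℝ | ∃ A : Finset N.V, N.Separates S A ∧ N.cutWeight A = w}

/-- `N'` is a mimicking network for `N`: for every partition of the terminals,
the minimum separating cuts in `N'` and `N` have equal weight. -/
def IsMimicking (N' N : Network k) : Prop :=
  ∀ S : Finset (Fin k), N'.mincut S = N.mincut S
/-- `F` is the edge set of a minimum `S`-separating cut of `N`. -/
def IsMinCutset (N : Network k) (S : Finset (Fin k))
    (F : Finset (Sym2 N.V)) : Prop :=
  ∃ A : Finset N.V, N.Separates S A ∧ N.cutset A = F ∧ N.cutWeight A = N.mincut S

end Network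

namespace Network

variable {k : ℕ}

theorem exists_separates (N : Network k) (S : Finset (Fin k)) : ∃ A, N.Separates S A :=
  ⟨S.image N.term, fun i => by simp [N.term_inj.eq_iff]⟩

theorem finite_cutWeights (N : Network k) (S : Finset (Fin k)) :
    {w : ℝ | ∃ A : Finset N.V, N.Separates S A ∧ N.cutWeight A = w}.Finite :=
  (Set.finite_range N.cutWeight).subset fun _ ⟨A, _, hA⟩ => ⟨A, hA⟩

theorem exists_cutWeight_eq_mincut (N : Network k) (S : Finset (Fin k)) :
    ∃ A, N.Separates S A ∧ N.cutWeight A = N.mincut S := by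
  obtain ⟨A, hA⟩ := N.exists_separates S
  exact Set.Nonempty.csInf_mem (s := {w : ℝ | ∃ A, N.Separates S A ∧ N.cutWeight A = w})
    ⟨_, A, hA, rfl⟩ (N.finite_cutWeights S)

theorem mincut_le_cutWeight (N : Network k) {S : Finset (Fin k)} {A : Finset N.V}
    (hA : N.Separates S A) : N.mincut S ≤ N.cutWeight A :=
  csInf_le (N.finite_cutWeights S).bddBelow ⟨A, hA, rfl⟩

/-- For any choice of terminal partitions, the vector of minimum cut weights is a linear
combination of `0`-`1` vectors, at most one for each edge. -/
theorem exists_mincut_mem_span (N : Network k) {ι : Type*} (f : ι → Finset (Fin k)) :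
    ∃ T : Finset (Set ι), T.card ≤ N.edges.card ∧
      (fun i => N.mincut (f i)) ∈
        Submodule.span ℝ (T.image fun X => X.indicator fun _ => (1 : ℝ) : Set (ι → ℝ)) := by
  choose A _ hA using fun i => N.exists_cutWeight_eq_mincut (f i)
  refine ⟨N.edges.image fun e => {i | e ∈ N.cutset (A i)}, Finset.card_image_le, ?_⟩
  have h : (fun i => N.mincut (f i)) = ∑ e ∈ N.edges,
      N.cost e • Set.indicator {i | e ∈ N.cutset (A i)} fun _ => (1 : ℝ) := by
    ext i
    have hsub : N.cutset (A i) ⊆ N.edges := Finset.filter_subset _ _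
    rw [← hA, cutWeight, Finset.sum_apply, ← Finset.sum_subset hsub]
    · exact Finset.sum_congr rfl fun e he => by simp [he]
    · intro e _ he
      simp [he]
  rw [h]
  refine Submodule.sum_mem _ fun e he => Submodule.smul_mem _ _ (Submodule.subset_span ?_)
  simp only [Finset.coe_image, Set.mem_image]
  exact ⟨_, ⟨e, he, rfl⟩, rfl⟩

end Network

/-- A nonempty open set is not covered by finitely many preimages, under a matrix `M`, of
subspaces of dimension less than the rank of `M`. -/
theorem IsOpen.exists_mulVec_notMem {m n κ : Type*} [Fintype m] [Fintype n] [Finite κ]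
    {U : Set (n → ℝ)} (hU : IsOpen U) (hne : U.Nonempty) (M : Matrix m n ℝ)
    (W : κ → Submodule ℝ (m → ℝ)) :
    ∃ x ∈ U, ∀ i, Module.finrank ℝ (W i) < M.rank → M.mulVec x ∉ W i := by
  by_contra! h
  have hnull : ∀ i : {i // Module.finrank ℝ (W i) < M.rank},
      MeasureTheory.volume (((W i).comap M.mulVecLin : Submodule ℝ (n → ℝ)) : Set (n → ℝ)) =
        0 := by
    rintro ⟨i, hi⟩
    refine MeasureTheory.Measure.addHaar_submodule _ _ fun htop => hi.not_ge ?_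
    exact Submodule.finrank_mono (LinearMap.range_le_iff_comap.2 htop)
  refine (hU.measure_pos MeasureTheory.volume hne).ne' ?_
  refine MeasureTheory.measure_mono_null (fun x hx => ?_) (MeasureTheory.measure_iUnion_null hnull)
  obtain ⟨i, hi, hxi⟩ := h x hx
  exact Set.mem_iUnion.2 ⟨⟨i, hi⟩, hxi⟩

/-- Main Technical Lemma (Krauthgamer–Rika): if all minimum terminal-separating
cutsets of `(G, c)` are unique, and `M` is the cutset-edge incidence matrix of
`(G, c)`, then there is a positive edge cost function `c̃` on the same graph such
that every mimicking network for `(G, c̃)` has at least `rank M` edges. -/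
theorem main_technical_lemma {k : ℕ} (N : Network k) (hpos : N.PosCosts)
    (huniq : ∀ S : Finset (Fin k), S ≠ ∅ → S ≠ Finset.univ →
      ∃! F : Finset (Sym2 N.V), N.IsMinCutset S F)
    (M : Matrix {S : Finset (Fin k) // S ≠ ∅ ∧ S ≠ Finset.univ} {e // e ∈ N.edges} ℝ)
    (hM : ∀ (S : {S : Finset (Fin k) // S ≠ ∅ ∧ S ≠ Finset.univ})
      (F : Finset (Sym2 N.V)), N.IsMinCutset S.1 F →
      ∀ e : {e // e ∈ N.edges}, M S e = if (e : Sym2 N.V) ∈ F then 1 else 0) :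
    ∃ ct : Sym2 N.V → ℝ, (∀ e ∈ N.edges, 0 < ct e) ∧
      ∀ N' : Network k, N'.PosCosts → N'.IsMimicking { N with cost := ct } →
        M.rank ≤ N'.edges.card := by
  choose F hF using fun S : {S : Finset (Fin k) // S ≠ ∅ ∧ S ≠ Finset.univ} =>
    (huniq S.1 S.2.1 S.2.2).exists
  choose A hA hAF hAmin using hF
  let U : Set ({e // e ∈ N.edges} → ℝ) := {x | (∀ e, 0 < x e) ∧
    ∀ S, ∀ B : Finset N.V, N.Separates S.1 B → N.cutset B ≠ F S →
      ∑ e, (if e.1 ∈ F S then x e else 0) < ∑ e, if e.1 ∈ N.cutset B then x e else 0}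
  have hUopen : IsOpen U := by
    simp only [U, Set.ofPred_and, Set.ofPred_forall]
    refine (isOpen_iInter_of_finite fun e =>
      isOpen_lt continuous_const (continuous_apply e)).inter ?_
    refine isOpen_iInter_of_finite fun S => isOpen_iInter_of_finite fun B =>
      isOpen_iInter_of_finite fun _ => isOpen_iInter_of_finite fun _ => isOpen_lt ?_ ?_ <;>
    · refine continuous_finsetSum _ fun e _ => ?_
      split_ifs <;> fun_prop
  have hsum : ∀ (c : Sym2 N.V → ℝ) (B : Finset N.V),
      ∑ e : {e // e ∈ N.edges}, (if e.1 ∈ N.cutset B then c e else 0) =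
        ∑ e ∈ N.cutset B, c e := by
    intro c B
    rw [Finset.sum_coe_sort N.edges fun e => if e ∈ N.cutset B then c e else 0,
      ← Finset.sum_filter]
    refine Finset.sum_congr (Finset.ext fun e => ?_) fun _ _ => rfl
    simp +contextual [Network.cutset]
  have hUne : U.Nonempty := by
    refine ⟨fun e => N.cost e, fun e => hpos e e.2, fun S B hB hBF => ?_⟩
    rw [← hAF, hsum, hsum]
    have hle := N.mincut_le_cutWeight hB
    have hne : N.cutWeight B ≠ N.mincut S := fun h =>
      hBF ((huniq S.1 S.2.1 S.2.2).unique ⟨B, hB, rfl, h⟩ ⟨A S, hA S, hAF S, hAmin S⟩)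
    exact (hAmin S).trans_lt (lt_of_le_of_ne hle hne.symm)
  obtain ⟨x, ⟨hxpos, hxmin⟩, hx⟩ := hUopen.exists_mulVec_notMem hUne M
    fun T : Finset (Set {S : Finset (Fin k) // S ≠ ∅ ∧ S ≠ Finset.univ}) =>
      Submodule.span ℝ (T.image fun X => X.indicator fun _ => (1 : ℝ) :
        Set ({S : Finset (Fin k) // S ≠ ∅ ∧ S ≠ Finset.univ} → ℝ))
  let ct : Sym2 N.V → ℝ := fun e => if h : e ∈ N.edges then x ⟨e, h⟩ else 0
  have hct : ∀ e : {e // e ∈ N.edges}, ct e = x e := fun e => dif_pos e.2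
  refine ⟨ct, fun e he => (hct ⟨e, he⟩).symm ▸ hxpos _, fun N' _ hN' => ?_⟩
  by_contra! hlt
  obtain ⟨T, hT, hmem⟩ := N'.exists_mincut_mem_span
    (Subtype.val : {S : Finset (Fin k) // S ≠ ∅ ∧ S ≠ Finset.univ} → _)
  refine hx T ((finrank_span_finset_le_card _).trans_lt
    ((Finset.card_image_le.trans hT).trans_lt hlt)) ?_
  suffices h : M.mulVec x = fun S => N'.mincut S.1 by
    rw [h]
    convert hmem
  ext S
  have hweight : ∀ B, ({ N with cost := ct } : Network k).cutWeight B =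
      ∑ e : {e // e ∈ N.edges}, if e.1 ∈ N.cutset B then x e else 0 := fun B => by
    simp only [← hct]
    exact (hsum ct B).symm
  have hMx : M.mulVec x S = ({ N with cost := ct } : Network k).cutWeight (A S) := by
    rw [hweight, Matrix.mulVec, dotProduct]
    refine Finset.sum_congr rfl fun e _ => ?_
    rw [hM S (F S) ⟨A S, hA S, hAF S, hAmin S⟩, hAF, ite_mul, one_mul, zero_mul]
  rw [hMx, hN' S.1]
  refine le_antisymm ?_ (Network.mincut_le_cutWeight { N with cost := ct } (hA S))
  obtain ⟨B, hB, hBmin⟩ := ({ N with cost := ct } : Network k).exists_cutWeight_eq_mincut S.1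
  rw [← hBmin, hweight, hweight, hAF]
  by_cases hBF : N.cutset B = F S
  · rw [hBF]
  · exact (hxmin S B hB hBF).le
end

section
/- Let r be a positive integer with r ≡ 2 (mod 4), let ℓ = C(2r+1, r), and let α be a rational number with α > r²·ℓ·C(ℓ, ℓ/2). In the three-layer network G(r, α), let S ⊆ Q be important (x ∈ S and |S| = r+1) and set S0 = S ∖ {x}. Then every minimum S-separating bipartition (A, V∖A) of G(r, α) satisfies u_{S0} ∈ A, and u_{S'} ∉ A for every S' ⊆ Q0 with |S'| = r and S' ≠ S0. -/
namespace DoubleExp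

/-- `ℓ = C(2r+1, r)`. -/
abbrev ell (r : ℕ) : ℕ := (2 * r + 1).choose r

/-- Index set of the middle layer `U`: subsets `S ⊆ Q0` of size `r`. -/
abbrev UIdx (r : ℕ) := {S : Finset (Fin (2 * r + 1)) // S.card = r}

/-- Index set of the last layer `W`: subsets `Z ⊆ U` of size `ℓ/2`. -/
abbrev WIdx (r : ℕ) := {Z : Finset (UIdx r) // Z.card = ell r / 2}

/-- The vertex set of `G(r, α)`: `Q0 ⊎ {x} ⊎ U ⊎ W`. -/
abbrev Vtx (r : ℕ) := (Fin (2 * r + 1) ⊕ Unit) ⊕ (UIdx r ⊕ WIdx r)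

/-- The terminal `q ∈ Q0`. -/
def vq (r : ℕ) (i : Fin (2 * r + 1)) : Vtx r := Sum.inl (Sum.inl i)

/-- The extra terminal `x`. -/
def vx (r : ℕ) : Vtx r := Sum.inl (Sum.inr ())

/-- The middle-layer vertex `u_S`. -/
def vu (r : ℕ) (S : UIdx r) : Vtx r := Sum.inr (Sum.inl S)

/-- The last-layer vertex `w_Z`. -/
def vw (r : ℕ) (Z : WIdx r) : Vtx r := Sum.inr (Sum.inr Z)

/-- The symmetric edge cost function of `G(r, α)`: `u_S q` costs
`(1 + 1/r + 1/r²)·α` if `q ∈ S` and `α` otherwise; `u_S w_Z` costs `1` if `u_S ∈ Z`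
and `0` otherwise; `x w_Z` costs `ℓ/2 − 1`; all other pairs are non-adjacent (cost `0`). -/
def cost (r : ℕ) (α : ℚ) : Vtx r → Vtx r → ℚ
  | Sum.inr (Sum.inl S), Sum.inl (Sum.inl q) =>
      if q ∈ S.1 then (1 + 1 / (r : ℚ) + 1 / (r : ℚ) ^ 2) * α else α
  | Sum.inl (Sum.inl q), Sum.inr (Sum.inl S) =>
      if q ∈ S.1 then (1 + 1 / (r : ℚ) + 1 / (r : ℚ) ^ 2) * α else α
  | Sum.inr (Sum.inl S), Sum.inr (Sum.inr Z) => if S ∈ Z.1 then 1 else 0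
  | Sum.inr (Sum.inr Z), Sum.inr (Sum.inl S) => if S ∈ Z.1 then 1 else 0
  | Sum.inl (Sum.inr _), Sum.inr (Sum.inr _) => (ell r : ℚ) / 2 - 1
  | Sum.inr (Sum.inr _), Sum.inl (Sum.inr _) => (ell r : ℚ) / 2 - 1
  | _, _ => 0

/-- The terminal set `Q = Q0 ∪ {x}`. -/
def Qset (r : ℕ) : Finset (Vtx r) :=
  (Finset.univ.image (vq r)) ∪ {vx r}

/-- The total cost of the edges crossing the bipartition `(A, V ∖ A)`. -/
def cutWeight (r : ℕ) (α : ℚ) (A : Finset (Vtx r)) : ℚ :=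
  ∑ a ∈ A, ∑ b ∈ Aᶜ, cost r α a b

/-- `(A, V ∖ A)` is an `S`-separating bipartition: `S ⊆ A` and `Q ∖ S ⊆ V ∖ A`. -/
def SepBip (r : ℕ) (S : Finset (Vtx r)) (A : Finset (Vtx r)) : Prop :=
  S ⊆ A ∧ ∀ t ∈ Qset r \ S, t ∉ A

/-- `(A, V ∖ A)` is a minimum `S`-separating bipartition of `G(r, α)`. -/
def IsMinSepBip (r : ℕ) (α : ℚ) (S : Finset (Vtx r)) (A : Finset (Vtx r)) : Prop :=
  SepBip r S A ∧ ∀ B : Finset (Vtx r), SepBip r S B → cutWeight r α A ≤ cutWeight r α B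

end DoubleExp

namespace DoubleExp

/-- The signed degree of `v` with respect to `A`: the change of the cut weight when `v` moves
to the side `A`. -/
def moveCost (r : ℕ) (α : ℚ) (A : Finset (Vtx r)) (v : Vtx r) : ℚ :=
  ∑ b, (if b ∈ A then -1 else 1) * cost r α v b

lemma cost_comm (r : ℕ) (α : ℚ) (a b : Vtx r) : cost r α a b = cost r α b a := by
  rcases a with (_ | _) | (_ | _) <;> rcases b with (_ | _) | (_ | _) <;> rfl

lemma cost_self (r : ℕ) (α : ℚ) (a : Vtx r) : cost r α a a = 0 := by
  rcases a with (_ | _) | (_ | _) <;> rfl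

lemma moveCost_eq (r : ℕ) (α : ℚ) (A : Finset (Vtx r)) (v : Vtx r) :
    moveCost r α A v = ∑ b ∈ Aᶜ, cost r α v b - ∑ b ∈ A, cost r α v b := by
  have h : ∀ b, (if b ∈ A then (-1 : ℚ) else 1) * cost r α v b =
      if b ∈ A then -cost r α v b else cost r α v b := by
    intro b; split_ifs <;> ring
  rw [moveCost, ← Finset.sum_add_sum_compl A, sub_eq_add_neg, add_comm, ← Finset.sum_neg_distrib]
  simp only [h]
  congr 1
  · exact Finset.sum_congr rfl fun b hb => if_neg (Finset.mem_compl.1 hb)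
  · exact Finset.sum_congr rfl fun b hb => if_pos hb

lemma cutWeight_insert (r : ℕ) (α : ℚ) {A : Finset (Vtx r)} {v : Vtx r} (hv : v ∉ A) :
    cutWeight r α (insert v A) = cutWeight r α A + moveCost r α A v := by
  have hc : Aᶜ = insert v (insert v A)ᶜ := by
    rw [Finset.compl_insert, Finset.insert_erase (Finset.mem_compl.2 hv)]
  have hv' : v ∉ (insert v A)ᶜ := by simp
  rw [moveCost_eq, cutWeight, cutWeight, Finset.sum_insert hv, hc]
  simp only [Finset.sum_insert hv', Finset.sum_add_distrib, cost_self, cost_comm r α _ v]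
  ring

lemma moveCost_erase (r : ℕ) (α : ℚ) (A : Finset (Vtx r)) (v : Vtx r) :
    moveCost r α (A.erase v) v = moveCost r α A v := by
  refine Finset.sum_congr rfl fun b _ => ?_
  by_cases hb : b = v
  · simp [hb, cost_self]
  · simp [hb]

lemma cutWeight_erase (r : ℕ) (α : ℚ) {A : Finset (Vtx r)} {v : Vtx r} (hv : v ∈ A) :
    cutWeight r α (A.erase v) = cutWeight r α A - moveCost r α A v := by
  have h := cutWeight_insert r α (Finset.notMem_erase v A)
  rw [Finset.insert_erase hv, moveCost_erase] at h
  linarith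

lemma vu_notMem_Qset (r : ℕ) (T : UIdx r) : vu r T ∉ Qset r := by
  simp [Qset, vu, vq, vx]

lemma IsMinSepBip.moveCost_nonneg {r : ℕ} {α : ℚ} {S A : Finset (Vtx r)}
    (hA : IsMinSepBip r α S A) {T : UIdx r} (hT : vu r T ∉ A) :
    0 ≤ moveCost r α A (vu r T) := by
  have h := hA.2 (insert (vu r T) A) ⟨hA.1.1.trans (Finset.subset_insert _ _), fun t ht => by
    rw [Finset.mem_insert, not_or]
    refine ⟨?_, hA.1.2 t ht⟩
    rintro rfl
    exact vu_notMem_Qset r T (Finset.mem_sdiff.1 ht).1⟩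
  rw [cutWeight_insert r α hT] at h
  linarith

lemma IsMinSepBip.moveCost_nonpos {r : ℕ} {α : ℚ} {S A : Finset (Vtx r)} (hSQ : S ⊆ Qset r)
    (hA : IsMinSepBip r α S A) {T : UIdx r} (hT : vu r T ∈ A) :
    moveCost r α A (vu r T) ≤ 0 := by
  have h := hA.2 (A.erase (vu r T)) ⟨fun t ht => Finset.mem_erase.2
      ⟨fun h => vu_notMem_Qset r T (h ▸ hSQ ht), hA.1.1 ht⟩,
    fun t ht h => hA.1.2 t ht (Finset.mem_of_mem_erase h)⟩
  rw [cutWeight_erase r α hT] at h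
  linarith

lemma card_WIdx (r : ℕ) : Fintype.card (WIdx r) = (ell r).choose (ell r / 2) := by
  rw [Fintype.card_finset_len, Fintype.card_finset_len, Fintype.card_fin]

lemma cost_vu_vq (r : ℕ) (α : ℚ) (T : UIdx r) (q : Fin (2 * r + 1)) :
    cost r α (vu r T) (vq r q) =
      if q ∈ T.1 then (1 + 1 / (r : ℚ) + 1 / (r : ℚ) ^ 2) * α else α := rfl

lemma cost_vu_vx (r : ℕ) (α : ℚ) (T : UIdx r) : cost r α (vu r T) (vx r) = 0 := rfl

lemma cost_vu_vu (r : ℕ) (α : ℚ) (T T' : UIdx r) : cost r α (vu r T) (vu r T') = 0 := rfl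

lemma cost_vu_vw (r : ℕ) (α : ℚ) (T : UIdx r) (Z : WIdx r) :
    cost r α (vu r T) (vw r Z) = if T ∈ Z.1 then 1 else 0 := rfl

lemma sum_Vtx (r : ℕ) (f : Vtx r → ℚ) :
    ∑ b, f b = (∑ q, f (vq r q) + f (vx r)) + (∑ T, f (vu r T) + ∑ Z, f (vw r Z)) := by
  simp [Fintype.sum_sum_type, vq, vx, vu, vw]

/-- Up to the edges towards `W`, the signed degree of `u_T` is determined by `|T ∩ S0|`. -/
lemma abs_moveCost_sub_le (r : ℕ) (α : ℚ) {A : Finset (Vtx r)} {S0 : Finset (Fin (2 * r + 1))}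
    (hS0 : S0.card = r) (hA : ∀ q, vq r q ∈ A ↔ q ∈ S0) (T : UIdx r) :
    |moveCost r α A (vu r T) -
        (1 + ((r : ℚ) - 2 * (T.1 ∩ S0).card) * (1 / (r : ℚ) + 1 / (r : ℚ) ^ 2)) * α| ≤
      ((ell r).choose (ell r / 2) : ℚ) := by
  set δ : ℚ := 1 / (r : ℚ) + 1 / (r : ℚ) ^ 2 with hδ
  have hterm : ∀ q : Fin (2 * r + 1),
      (if vq r q ∈ A then (-1 : ℚ) else 1) * cost r α (vu r T) (vq r q) =
        α - 2 * α * (if q ∈ S0 then 1 else 0) + δ * α * (if q ∈ T.1 then 1 else 0)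
          - 2 * δ * α * (if q ∈ T.1 ∩ S0 then 1 else 0) := by
    intro q
    simp only [hA, cost_vu_vq, Finset.mem_inter]
    by_cases h1 : q ∈ S0 <;> by_cases h2 : q ∈ T.1 <;> simp [h1, h2, hδ] <;> ring
  have hQ : ∑ q, (if vq r q ∈ A then (-1 : ℚ) else 1) * cost r α (vu r T) (vq r q) =
      (1 + ((r : ℚ) - 2 * (T.1 ∩ S0).card) * δ) * α := by
    simp only [hterm, Finset.sum_add_distrib, Finset.sum_sub_distrib, ← Finset.mul_sum,
      Finset.sum_boole, Finset.filter_univ_mem, hS0, T.2]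
    simp
    ring
  have hsplit : moveCost r α A (vu r T) =
      ∑ q, (if vq r q ∈ A then (-1 : ℚ) else 1) * cost r α (vu r T) (vq r q) +
        ∑ Z, (if vw r Z ∈ A then (-1 : ℚ) else 1) * cost r α (vu r T) (vw r Z) := by
    simp only [moveCost, sum_Vtx, cost_vu_vx, cost_vu_vu, mul_zero, Finset.sum_const_zero,
      add_zero, zero_add]
  rw [hsplit, hQ, add_sub_cancel_left, ← card_WIdx]
  refine (Finset.abs_sum_le_sum_abs _ _).trans ?_
  refine (Finset.sum_le_card_nsmul _ _ 1 fun Z _ => ?_).trans (by simp)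
  rw [cost_vu_vw]
  split_ifs <;> simp

end DoubleExp

open DoubleExp in
/-- For an important set `S ⊆ Q` (with `S0 = S \ {x}`) and `α > r²·ℓ·C(ℓ, ℓ/2)`,
every minimum `S`-separating bipartition of `G(r, α)` puts `u_{S0}` on the `S`-side
and every other middle-layer vertex `u_{S'}` on the opposite side. -/
theorem uS0_side (r : ℕ) (hr : 0 < r) (hmod : r % 4 = 2) (α : ℚ)
    (hα : (r : ℚ) ^ 2 * (ell r : ℚ) * ((ell r).choose (ell r / 2) : ℚ) < α)
    (S : Finset (Vtx r)) (hSQ : S ⊆ Qset r) (hxS : vx r ∈ S) (hScard : S.card = r + 1)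
    (S0 : Finset (Fin (2 * r + 1))) (hS0 : S0.image (vq r) = S.erase (vx r))
    (hS0card : S0.card = r)
    (A : Finset (Vtx r)) (hA : IsMinSepBip r α S A) :
    vu r ⟨S0, hS0card⟩ ∈ A ∧
      ∀ S' : UIdx r, S' ≠ ⟨S0, hS0card⟩ → vu r S' ∉ A := by
  have hq : ∀ q, vq r q ∈ A ↔ q ∈ S0 := by
    intro q
    have hmem : vq r q ∈ S ↔ q ∈ S0 := by
      have h := Finset.ext_iff.1 hS0 (vq r q)
      simpa [vq, vx] using h.symm
    refine ⟨fun h => ?_, fun h => hA.1.1 (hmem.2 h)⟩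
    by_contra hn
    exact hA.1.2 (vq r q) (Finset.mem_sdiff.2 ⟨by simp [Qset], mt hmem.1 hn⟩) h
  have hr1 : (1 : ℚ) ≤ r := by exact_mod_cast hr
  have hr0 : (0 : ℚ) < r := by linarith
  have hℓ : (1 : ℚ) ≤ ell r := by
    exact_mod_cast Nat.choose_pos (by omega : r ≤ 2 * r + 1)
  set C : ℚ := ((ell r).choose (ell r / 2) : ℚ) with hC
  have hC0 : 0 ≤ C := by positivity
  have hα0 : 0 < α := lt_of_le_of_lt (by positivity) hα
  have hCα : C < α / r := by
    rw [lt_div_iff₀ hr0]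
    refine lt_of_le_of_lt ?_ hα
    calc C * r = r * 1 * C := by ring
      _ ≤ (r : ℚ) ^ 2 * ell r * C := by gcongr; nlinarith
  constructor
  · by_contra hn
    have h1 := hA.moveCost_nonneg hn
    have h2 := (abs_le.1 (abs_moveCost_sub_le r α hS0card hq ⟨S0, hS0card⟩)).2
    rw [Finset.inter_self, hS0card] at h2
    have h3 : (1 + ((r : ℚ) - 2 * r) * (1 / (r : ℚ) + 1 / (r : ℚ) ^ 2)) * α = -(α / r) := by
      field_simp
      ring
    linarith
  · intro T hT hn
    have h1 := hA.moveCost_nonpos hSQ hn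
    have h2 := (abs_le.1 (abs_moveCost_sub_le r α hS0card hq T)).1
    have hk : (T.1 ∩ S0).card < r := by
      refine lt_of_lt_of_eq ?_ T.2
      refine Finset.card_lt_card (Finset.inter_subset_left.ssubset_of_ne fun h => hT ?_)
      exact Subtype.ext (Finset.eq_of_subset_of_card_le (Finset.inter_eq_left.1 h)
        (by rw [hS0card, T.2]))
    have hk' : ((T.1 ∩ S0).card : ℚ) ≤ r - 1 := by
      rw [le_sub_iff_add_le]
      exact_mod_cast hk
    have h3 : α / r ≤
        (1 + ((r : ℚ) - 2 * (T.1 ∩ S0).card) * (1 / (r : ℚ) + 1 / (r : ℚ) ^ 2)) * α := by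
      calc α / r ≤ (1 + ((r : ℚ) - 2 * (r - 1)) * (1 / (r : ℚ) + 1 / (r : ℚ) ^ 2)) * α := by
            have : (1 + ((r : ℚ) - 2 * (r - 1)) * (1 / (r : ℚ) + 1 / (r : ℚ) ^ 2)) * α =
                α / r + 2 * α / r ^ 2 := by
              field_simp
              ring
            rw [this]
            exact le_add_of_nonneg_right (by positivity)
        _ ≤ _ := by gcongr
    linarith
end
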